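/- For every database D, the subwalk order ⊑ is a well-partial-order on Walks(D): for every infinite sequence w₁, w₂, … of walks in D there exist indices i < j such that w_i ⊑ w_j. -/

import Mathlib

namespace RPQ

/-- Vertex identifiers. -/
abbrev V : Type := ℕ
/-- Edge identifiers. -/
abbrev Edg : Type := ℕ
/-- Labels. -/
abbrev Lab : Type := ℕ

/-- A walk: a nonempty alternating sequence `v₀,e₁,v₁,…,e_k,v_k`, encoded as the
initial vertex together with the list of (edge, next-vertex) pairs. -/
structure Walk where
  head : V
  steps : List (Edg × V)
deriving DecidableEq

namespace Walk

def length (w : Walk) : ℕ := w.steps.length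
def src (w : Walk) : V := w.head
def tgt (w : Walk) : V := (w.steps.map Prod.snd).getLastD w.head
/-- The pair of endpoints of a walk. -/
def ep (w : Walk) : V × V := (w.src, w.tgt)
def vertexList (w : Walk) : List V := w.head :: w.steps.map Prod.snd
def edgeList (w : Walk) : List Edg := w.steps.map Prod.fst
/-- Concatenation of walks (meaningful when `w.tgt = w'.src`). -/
def concat (w w' : Walk) : Walk := ⟨w.head, w.steps ++ w'.steps⟩

end Walk

/-- A graph database. -/
structure Database where
  labels : Finset Lab
  verts : Finset V
  edges : Finset Edg
  src : Edg → V
  tgt : Edg → V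
  lbl : Edg → Lab
  src_mem : ∀ e ∈ edges, src e ∈ verts
  tgt_mem : ∀ e ∈ edges, tgt e ∈ verts
  lbl_mem : ∀ e ∈ edges, lbl e ∈ labels

def chainFrom (D : Database) : V → List (Edg × V) → Prop
  | _, [] => True
  | v, (e, v') :: rest =>
      e ∈ D.edges ∧ D.src e = v ∧ D.tgt e = v' ∧ chainFrom D v' rest

/-- `w` is consistent with `D`, i.e. `w` is a walk in `D`. -/
def Walk.Consistent (D : Database) (w : Walk) : Prop :=
  w.head ∈ D.verts ∧ chainFrom D w.head w.steps

/-- The set of walks in `D`. -/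
def Walks (D : Database) : Set Walk := {w | w.Consistent D}

/-- The label of a walk in `D`: the word of its successive edge labels. -/
def Walk.label (D : Database) (w : Walk) : List Lab :=
  w.steps.map fun p => D.lbl p.1

abbrev RE := RegularExpression Lab

/-- Matches of `R` in `D`: walks in `D` whose label conforms to `R`. -/
def Matches (D : Database) (R : RE) : Set Walk :=
  {w | w.Consistent D ∧ w.label D ∈ R.matches'}

/-- A semantics maps a database and a query to a finite subset of its matches. -/
def IsSemantics (S : Database → RE → Set Walk) : Prop :=
  ∀ D R, S D R ⊆ Matches D R ∧ (S D R).Finite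

/-- `S` is walk-based. -/
def WalkBased (S : Database → RE → Set Walk) : Prop :=
  ∃ r : Set Walk → Set Walk, ∀ D R, S D R = r (Matches D R)

/-- The semantics defined by a filter `f`. -/
def FilterSem (f : Walk → Bool) (D : Database) (R : RE) : Set Walk :=
  {w ∈ Matches D R | f w = true}

/-- Componentwise inclusion of databases. -/
def Database.Sub (D D' : Database) : Prop :=
  D.labels ⊆ D'.labels ∧ D.verts ⊆ D'.verts ∧ D.edges ⊆ D'.edges ∧
    ∀ e ∈ D.edges, D'.src e = D.src e ∧ D'.tgt e = D.tgt e ∧ D'.lbl e = D.lbl e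

def IsPartialOrderRel (le : Walk → Walk → Prop) : Prop :=
  (∀ w, le w w) ∧ (∀ a b c, le a b → le b c → le a c) ∧ ∀ a b, le a b → le b a → a = b

/-- `le` is a well-partial-order on the walks of `D`. -/
def IsWpoOn (le : Walk → Walk → Prop) (D : Database) : Prop :=
  ∀ f : ℕ → Walk, (∀ n, (f n).Consistent D) → ∃ i j, i < j ∧ le (f i) (f j)

/-- Suitable order: a partial order on walks that is a wpo on `Walks D` for each `D`. -/
def Suitable (le : Walk → Walk → Prop) : Prop :=
  IsPartialOrderRel le ∧ ∀ D, IsWpoOn le D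

/-- The semantics based on the order `le`: the `le`-minimal matches among those
with the same endpoints. -/
def OrderSem (le : Walk → Walk → Prop) (D : Database) (R : RE) : Set Walk :=
  {w ∈ Matches D R | ∀ w' ∈ Matches D R, w'.ep = w.ep → le w' w → w' = w}

def Monotonous (S : Database → RE → Set Walk) : Prop :=
  ∀ D D' R, D.Sub D' → S D R ⊆ S D' R

def CoMonotonous (S : Database → RE → Set Walk) : Prop :=
  ∀ D D' R, D.Sub D' → S D' R ∩ Walks D ⊆ S D R

def Stabilizing (S : Database → RE → Set Walk) : Prop :=
  ∀ (D : Database) (Rs : ℕ → RE),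
    (∀ i j, i ≤ j → ∀ u, u ∈ (Rs i).matches' → u ∈ (Rs j).matches') →
    ∃ N, ∀ n, N ≤ n → S D (Rs n) = S D (Rs N)

/-- Concatenation lifted to sets of walks. -/
def setConcat (W W' : Set Walk) : Set Walk :=
  {u | ∃ w ∈ W, ∃ w' ∈ W', w.tgt = w'.src ∧ u = w.concat w'}

/-- `setStar W` : all concatenations `w₁·…·w_k` (k ≥ 1) of walks of `W`. -/
inductive setStar (W : Set Walk) : Walk → Prop
  | base : ∀ w ∈ W, setStar W w
  | step : ∀ u w, setStar W u → w ∈ W → u.tgt = w.src → setStar W (u.concat w)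

/-- Walks jointly consistent with some database. -/
def ConsistentPair (w w' : Walk) : Prop :=
  ∃ D : Database, w.Consistent D ∧ w'.Consistent D

/-- The trimming of an order. -/
def trimRel (le : Walk → Walk → Prop) (w w' : Walk) : Prop :=
  ConsistentPair w w' ∧ w.ep = w'.ep ∧ le w w'

def Trimmed (le : Walk → Walk → Prop) : Prop := trimRel le = le

/-- `le` respects element inclusion. -/
def RespectsElemIncl (le : Walk → Walk → Prop) : Prop :=
  ∀ w w', le w w' →
    (∀ v ∈ w.vertexList, v ∈ w'.vertexList) ∧ ∀ e ∈ w.edgeList, e ∈ w'.edgeList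

/-- Action of a relabeling on a database. -/
def Database.relabel (π : Equiv.Perm Lab) (D : Database) : Database where
  labels := D.labels.image (⇑π)
  verts := D.verts
  edges := D.edges
  src := D.src
  tgt := D.tgt
  lbl := fun e => π (D.lbl e)
  src_mem := D.src_mem
  tgt_mem := D.tgt_mem
  lbl_mem := fun e he => Finset.mem_image_of_mem (⇑π) (D.lbl_mem e he)

/-- Action of a renaming on a walk. -/
def Walk.rename (νv : Equiv.Perm V) (νe : Equiv.Perm Edg) (w : Walk) : Walk :=
  ⟨νv w.head, w.steps.map fun p => (νe p.1, νv p.2)⟩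

/-- Action of a renaming on a database. -/
def Database.rename (νv : Equiv.Perm V) (νe : Equiv.Perm Edg) (D : Database) :
    Database where
  labels := D.labels
  verts := D.verts.image (⇑νv)
  edges := D.edges.image (⇑νe)
  src := fun e => νv (D.src (νe.symm e))
  tgt := fun e => νv (D.tgt (νe.symm e))
  lbl := fun e => D.lbl (νe.symm e)
  src_mem := by
    intro e he
    obtain ⟨e', he', rfl⟩ := Finset.mem_image.mp he
    simpa using Finset.mem_image_of_mem (⇑νv) (D.src_mem e' he')
  tgt_mem := by
    intro e he
    obtain ⟨e', he', rfl⟩ := Finset.mem_image.mp he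
    simpa using Finset.mem_image_of_mem (⇑νv) (D.tgt_mem e' he')
  lbl_mem := by
    intro e he
    obtain ⟨e', he', rfl⟩ := Finset.mem_image.mp he
    simpa using D.lbl_mem e' he'

/-- Identifier independence. -/
def IdIndependent (S : Database → RE → Set Walk) : Prop :=
  ∀ (νv : Equiv.Perm V) (νe : Equiv.Perm Edg) (D : Database) (R : RE),
    Walk.rename νv νe '' S D R = S (Database.rename νv νe D) R

/-- Unbounded semantics. -/
def Unbounded (S : Database → RE → Set Walk) : Prop :=
  ∀ n : ℕ, ∃ (D : Database) (R : RE) (w : Walk), w ∈ S D R ∧ n ≤ w.length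

/-- Shortest-walk semantics. -/
def Sh (D : Database) (R : RE) : Set Walk :=
  {w ∈ Matches D R | ∀ w' ∈ Matches D R, w'.ep = w.ep → w.length ≤ w'.length}

/-- The factor-inserting relation `F`. -/
def FactorIns (w w' : Walk) : Prop :=
  ∃ w₁ w₂ w₃ : Walk, w₁.tgt = w₂.src ∧ w₂.tgt = w₃.src ∧ w₁.tgt = w₃.src ∧
    w = w₁.concat w₃ ∧ w' = (w₁.concat w₂).concat w₃

/-- The subwalk order: reflexive–transitive closure of `FactorIns`. -/
def SubwalkOrd : Walk → Walk → Prop := Relation.ReflTransGen FactorIns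

@[simp] theorem Walk.tgt_cons (v : V) (a : Edg × V) (l : List (Edg × V)) :
    (⟨v, a :: l⟩ : Walk).tgt = (⟨a.2, l⟩ : Walk).tgt := by
  simp only [Walk.tgt, List.map_cons, List.getLastD_cons]

@[simp] theorem Walk.tgt_append_singleton (v : V) (p : List (Edg × V)) (a : Edg × V) :
    (⟨v, p ++ [a]⟩ : Walk).tgt = a.2 := by
  simp [Walk.tgt]

theorem FactorIns.cons {w w' : Walk} (h : FactorIns w w') (v : V) (e : Edg) :
    FactorIns ⟨v, (e, w.head) :: w.steps⟩ ⟨v, (e, w'.head) :: w'.steps⟩ := by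
  obtain ⟨w₁, w₂, w₃, h₁₂, h₂₃, h₁₃, rfl, rfl⟩ := h
  refine ⟨⟨v, (e, w₁.head) :: w₁.steps⟩, w₂, w₃, ?_, h₂₃, ?_, rfl, rfl⟩
  · simpa using h₁₂
  · simpa using h₁₃

theorem SubwalkOrd.cons {w w' : Walk} (h : SubwalkOrd w w') (v : V) (e : Edg) :
    SubwalkOrd ⟨v, (e, w.head) :: w.steps⟩ ⟨v, (e, w'.head) :: w'.steps⟩ :=
  Relation.ReflTransGen.lift (fun w : Walk => (⟨v, (e, w.head) :: w.steps⟩ : Walk))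
    (fun _ _ h => h.cons v e) _ _ h

/-- A closed walk can be inserted at the beginning. -/
theorem factorIns_append_left {v : V} {p : List (Edg × V)} (hp : (⟨v, p⟩ : Walk).tgt = v)
    (l : List (Edg × V)) : FactorIns ⟨v, l⟩ ⟨v, p ++ l⟩ :=
  ⟨⟨v, []⟩, ⟨v, p⟩, ⟨v, l⟩, rfl, hp, rfl, rfl, rfl⟩

/-- Between walks of a database with the same endpoints, an embedding of the sequences of steps
yields an embedding for the subwalk order; `p` is the part of the larger walk that still
has to be inserted in front. -/
theorem subwalkOrd_append_of_sublist (D : Database) {l l' : List (Edg × V)}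
    (h : l.Sublist l') : ∀ {v v' : V} (p : List (Edg × V)), chainFrom D v l →
      chainFrom D v' l' → (⟨v, p⟩ : Walk).tgt = v' →
      (⟨v, l⟩ : Walk).tgt = (⟨v', l'⟩ : Walk).tgt → SubwalkOrd ⟨v, l⟩ ⟨v, p ++ l'⟩ := by
  induction h with
  | slnil =>
    intro v v' p _ _ hp ht
    exact .single (factorIns_append_left (hp.trans ht.symm) [])
  | cons a _ ih =>
    intro v v' p hl hl' hp ht
    simpa using ih (p ++ [a]) hl hl'.2.2.2 (by simp)
      (by simpa [hl'.2.2.1] using ht)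
  | cons_cons a _ ih =>
    obtain ⟨e, x⟩ := a
    intro v v' p hl hl' hp ht
    obtain rfl : v = v' := hl.2.1.symm.trans hl'.2.1
    have := ih [] hl.2.2.2 hl'.2.2.2 rfl (by simpa using ht)
    exact (this.cons v e).tail (factorIns_append_left hp _)

theorem chainFrom.steps_mem {D : Database} {v : V} {l : List (Edg × V)} (h : chainFrom D v l) :
    ∀ a ∈ l, a ∈ D.edges ×ˢ D.verts := by
  induction l generalizing v with
  | nil => simp
  | cons a l ih =>
    obtain ⟨e, x⟩ := a
    obtain ⟨he, -, rfl, h⟩ := h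
    simpa [he, D.tgt_mem _ he] using ih h

theorem chainFrom.tgt_mem {D : Database} {v : V} {l : List (Edg × V)} (hv : v ∈ D.verts)
    (h : chainFrom D v l) : (⟨v, l⟩ : Walk).tgt ∈ D.verts := by
  induction l generalizing v with
  | nil => exact hv
  | cons a l ih =>
    obtain ⟨e, x⟩ := a
    obtain ⟨he, -, rfl, h⟩ := h
    rw [Walk.tgt_cons]
    exact ih (D.tgt_mem _ he) h

/-- For every database `D`, the subwalk order is a well-partial-order on `Walks D`. -/
theorem subwalkOrd_wpo (D : Database) (f : ℕ → Walk)
    (hf : ∀ n, (f n).Consistent D) :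
    ∃ i j, i < j ∧ SubwalkOrd (f i) (f j) := by
  have hends := (D.verts ×ˢ D.verts).partiallyWellOrderedOn (r := Eq)
  have hsteps := Set.PartiallyWellOrderedOn.partiallyWellOrderedOn_sublistForall₂ Eq
    ((D.edges ×ˢ D.verts).partiallyWellOrderedOn (r := Eq))
  obtain ⟨i, j, hij, hep, hsub⟩ := (hends.prod hsteps).exists_lt
    (f := fun n => ((f n).ep, (f n).steps)) fun n =>
      ⟨Finset.mem_product.2 ⟨(hf n).1, (hf n).2.tgt_mem (hf n).1⟩, (hf n).2.steps_mem⟩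
  obtain ⟨l, heq, hl⟩ := List.sublistForall₂_iff.1 hsub
  rw [List.forall₂_eq_eq_eq] at heq
  subst heq
  obtain ⟨hsrc, htgt⟩ := Prod.mk.inj hep
  refine ⟨i, j, hij, ?_⟩
  have hi := (hf i).2
  have hj := (hf j).2
  revert hsrc htgt hl hi hj
  generalize f i = w
  generalize f j = w'
  obtain ⟨v, l⟩ := w
  obtain ⟨v', l'⟩ := w'
  rintro hl (rfl : v = v') htgt hi hj
  exact subwalkOrd_append_of_sublist D hl [] hi hj rfl htgt

end RPQ
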